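/- For every n ≥ 1, if S is the complete right chain on n vertices and T is the complete left chain on n vertices, then the chain distance satisfies C(S,T) = n − 1. -/

import Mathlib

/-- Rooted binary trees with vertices labeled by `α`: each vertex has an optional
left child and an optional right child; `nil` denotes the absent (empty) tree. -/
inductive BT (α : Type) : Type
  | nil : BT α
  | node : BT α → α → BT α → BT α

namespace BT

variable {α : Type}

/-- The number of vertices of a tree. -/
def size : BT α → ℕ
  | nil => 0
  | node l _ r => size l + size r + 1

/-- The in-order (infix) traversal sequence of the labels of a tree:
left subtree first, then the root, then the right subtree. -/
def inorder : BT α → List α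
  | nil => []
  | node l x r => inorder l ++ x :: inorder r

/-- The number of vertices of the tree having a (non-null) right child. -/
def rightChildCount : BT α → ℕ
  | nil => 0
  | node l _ nil => rightChildCount l
  | node l _ (node rl y rr) => rightChildCount l + rightChildCount (node rl y rr) + 1

/-- The number of vertices of the tree having a (non-null) left child. -/
def leftChildCount : BT α → ℕ
  | nil => 0
  | node nil _ r => leftChildCount r
  | node (node ll y lr) _ r => leftChildCount (node ll y lr) + leftChildCount r + 1

/-- `L T`: the number of maximal left chains of `T`.  A left chain is a sequence of
vertices each linked to the next by a left-child pointer (a single vertex is a chain);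
a maximal left chain is one not contained in any other left chain.  Each maximal left
chain is uniquely determined by its topmost vertex, which is either the root of the
tree or a right child of some vertex; moreover the maximal left chain headed by the
root of a nonempty left subtree `l` merges with its parent, which yields the
recursion below. -/
def L : BT α → ℕ
  | nil => 0
  | node nil _ r => 1 + L r
  | node (node ll y lr) _ r => L (node ll y lr) + L r

/-- `R T`: the number of maximal right chains of `T` (mirror image of `L`). -/
def R : BT α → ℕ
  | nil => 0
  | node l _ nil => R l + 1
  | node l _ (node rl y rr) => R l + R (node rl y rr)

/-- The complete left chain on `n` vertices: the tree in which all `n` vertices are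
linked by left-child pointers. -/
def leftChain : ℕ → BT Unit
  | 0 => nil
  | n + 1 => node (leftChain n) () nil

/-- The complete right chain on `n` vertices: the tree in which all `n` vertices are
linked by right-child pointers. -/
def rightChain : ℕ → BT Unit
  | 0 => nil
  | n + 1 => node nil () (rightChain n)

/-- `SpliceL A w U V lv` captures the local effect of the direct chain rotation
`rot([u-v], w)` for a **left** chain `[u-v]`: here `U` is the subtree rooted at `u`
(`u` being the right child of `w`), `A` is the left subtree of `w` and `w` is its
label, `[u-v]` is the left chain going from `u` down (along left-child pointers) to
`v` inside `U`, `lv` is the former left subtree of `v`, and `V` is the tree replacing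
the subtree `node A w U` rooted at `w`: the vertex `u` takes the place of `w`, `w`
becomes the left child of `v`, and the former left subtree `lv` of `v` (if any)
becomes the right subtree of `w`.  The chain `[u-v]` is maximal iff `lv = nil`. -/
inductive SpliceL (A : BT α) (w : α) : BT α → BT α → BT α → Prop
  | base (lv rv : BT α) (v : α) :
      SpliceL A w (node lv v rv) (node (node A w lv) v rv) lv
  | step {lu lu' lv : BT α} (c : α) (ru : BT α) :
      SpliceL A w lu lu' lv → SpliceL A w (node lu c ru) (node lu' c ru) lv

/-- `SpliceR A w U V rv`: mirror image of `SpliceL`, i.e. the local effect of the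
direct chain rotation `rot([u-v], w)` for a **right** chain `[u-v]`: `U` is the
subtree rooted at `u` (`u` being the left child of `w`), `A` is the right subtree of
`w`, `[u-v]` is the right chain from `u` down to `v` inside `U`, `rv` is the former
right subtree of `v`, and `V` replaces the subtree `node U w A` rooted at `w`: `u`
takes the place of `w`, `w` becomes the right child of `v`, and the former right
subtree `rv` of `v` (if any) becomes the left subtree of `w`.
The chain `[u-v]` is maximal iff `rv = nil`. -/
inductive SpliceR (A : BT α) (w : α) : BT α → BT α → BT α → Prop
  | base (lv rv : BT α) (v : α) :
      SpliceR A w (node lv v rv) (node lv v (node rv w A)) rv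
  | step {ru ru' rv : BT α} (lu : BT α) (c : α) :
      SpliceR A w ru ru' rv → SpliceR A w (node lu c ru) (node lu c ru') rv

/-- `Ctx Y Y' W W'`: the tree `Y'` is obtained from `Y` by replacing one occurrence
of the subtree `W`, rooted at some vertex of `Y` (or `Y` itself), by the tree `W'`. -/
inductive Ctx : BT α → BT α → BT α → BT α → Prop
  | refl (W W' : BT α) : Ctx W W' W W'
  | left {l l' W W' : BT α} (x : α) (r : BT α) :
      Ctx l l' W W' → Ctx (node l x r) (node l' x r) W W'
  | right {r r' W W' : BT α} (l : BT α) (x : α) :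
      Ctx r r' W W' → Ctx (node l x r) (node l x r') W W'

/-- `Y'` is obtained from `Y` by one **direct** chain rotation `rot([u-v], w)`,
performed either on a left chain or (symmetrically) on a right chain, at an arbitrary
vertex `w` of `Y`. -/
def DirectRot (Y Y' : BT α) : Prop :=
  (∃ A w U V lv, SpliceL A w U V lv ∧ Ctx Y Y' (node A w U) V) ∨
  (∃ A w U V rv, SpliceR A w U V rv ∧ Ctx Y Y' (node U w A) V)

/-- `IChainL A w B X X'` captures the data of the inverse chain rotation
`rot(w, [u-v])` for a **left** chain `[u-v]`: `X` is the subtree rooted at `u`,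
`[u-v]` is the left chain from `u` down to `v` inside `X`, and the vertex `w` (with
label `w`, left subtree `A` and right subtree `B`) is the left child of `v`; `X'` is
`X` with the left child `w` of `v` replaced by `B` (the former right subtree of `w`
becomes the left subtree of `v`).  The rotation replaces the subtree `X` by
`node A w X'`: `w` takes the place of `u` and `u` becomes the right child of `w`. -/
inductive IChainL (A : BT α) (w : α) (B : BT α) : BT α → BT α → Prop
  | base (v : α) (rv : BT α) :
      IChainL A w B (node (node A w B) v rv) (node B v rv)
  | step {lu lu' : BT α} (c : α) (ru : BT α) :
      IChainL A w B lu lu' → IChainL A w B (node lu c ru) (node lu' c ru)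

/-- `IChainR B w A X X'`: mirror image of `IChainL`, for the inverse chain rotation
`rot(w, [u-v])` on a **right** chain `[u-v]`: `X` is the subtree rooted at `u`, the
vertex `w` (with left subtree `B` and right subtree `A`) is the right child of `v`;
`X'` is `X` with the right child `w` of `v` replaced by `B`.  The rotation replaces
`X` by `node X' w A`: `w` takes the place of `u` and `u` becomes the left child
of `w`. -/
inductive IChainR (B : BT α) (w : α) (A : BT α) : BT α → BT α → Prop
  | base (v : α) (lv : BT α) :
      IChainR B w A (node lv v (node B w A)) (node lv v B)
  | step {ru ru' : BT α} (lu : BT α) (c : α) :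
      IChainR B w A ru ru' → IChainR B w A (node lu c ru) (node lu c ru')

/-- `Y'` is obtained from `Y` by one **inverse** chain rotation `rot(w, [u-v])`,
performed either on a left chain or (symmetrically) on a right chain, anywhere
in `Y`. -/
def InvRot (Y Y' : BT α) : Prop :=
  (∃ A w B X X', IChainL A w B X X' ∧ Ctx Y Y' X (node A w X')) ∨
  (∃ B w A X X', IChainR B w A X X' ∧ Ctx Y Y' X (node X' w A))

/-- One chain rotation (c-rotation), direct or inverse. -/
def CStep (Y Y' : BT α) : Prop := DirectRot Y Y' ∨ InvRot Y Y'

/-- `ReachIn k S T`: `S` can be transformed into `T` by a sequence of exactly `k`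
chain rotations (each direct or inverse). -/
def ReachIn : ℕ → BT α → BT α → Prop
  | 0 => fun S T => S = T
  | k + 1 => fun S T => ∃ Y, CStep S Y ∧ ReachIn k Y T

/-- `DReachIn k S T`: `S` can be transformed into `T` by a sequence of exactly `k`
**direct** chain rotations. -/
def DReachIn : ℕ → BT α → BT α → Prop
  | 0 => fun S T => S = T
  | k + 1 => fun S T => ∃ Y, DirectRot S Y ∧ DReachIn k Y T

/-- The chain distance `C(S,T)`: the minimum number of chain rotations (direct or
inverse) needed to transform `S` into `T`. -/
noncomputable def chainDist (S T : BT α) : ℕ := sInf {k | ReachIn k S T}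

end BT

namespace BT

variable {α : Type}

/-- `1` if the tree has a root vertex, `0` if it is empty. -/
def rootCount : BT α → ℕ
  | nil => 0
  | node _ _ _ => 1

@[simp] lemma rootCount_nil : rootCount (nil : BT α) = 0 := rfl

@[simp] lemma rootCount_node (l : BT α) (x : α) (r : BT α) : rootCount (node l x r) = 1 := rfl

lemma rootCount_le_one (t : BT α) : rootCount t ≤ 1 := by
  cases t <;> simp

@[simp] lemma leftChildCount_nil : leftChildCount (nil : BT α) = 0 := by
  simp [leftChildCount]

@[simp] lemma leftChildCount_node (l : BT α) (x : α) (r : BT α) :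
    leftChildCount (node l x r) = leftChildCount l + leftChildCount r + rootCount l := by
  cases l <;> simp [leftChildCount]

lemma SpliceL.leftChildCount_add_rootCount {A U V lv : BT α} {w : α} (h : SpliceL A w U V lv) :
    rootCount U = 1 ∧ rootCount V = 1 ∧
      leftChildCount V + rootCount lv =
        leftChildCount U + leftChildCount A + rootCount A + 1 := by
  induction h with
  | base => simp; omega
  | step => simp; omega

lemma SpliceR.leftChildCount_eq {A U V rv : BT α} {w : α} (h : SpliceR A w U V rv) :
    rootCount U = 1 ∧ rootCount V = 1 ∧
      leftChildCount V = leftChildCount U + leftChildCount A + rootCount rv := by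
  induction h with
  | base => simp; omega
  | step => simp; omega

lemma IChainL.leftChildCount_add_rootCount {A B X X' : BT α} {w : α} (h : IChainL A w B X X') :
    rootCount X = 1 ∧ rootCount X' = 1 ∧
      leftChildCount X + rootCount B =
        leftChildCount X' + leftChildCount A + rootCount A + 1 := by
  induction h with
  | base => simp; omega
  | step => simp; omega

lemma IChainR.leftChildCount_eq {A B X X' : BT α} {w : α} (h : IChainR B w A X X') :
    rootCount X = 1 ∧ rootCount X' = 1 ∧
      leftChildCount X = leftChildCount X' + leftChildCount A + rootCount B := by
  induction h with
  | base => simp; omega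
  | step => simp; omega

lemma Ctx.leftChildCount_le {Y Y' W W' : BT α} {k : ℕ} (h : Ctx Y Y' W W')
    (hroot : rootCount W' = rootCount W) (hle : leftChildCount W' ≤ leftChildCount W + k) :
    rootCount Y' = rootCount Y ∧ leftChildCount Y' ≤ leftChildCount Y + k := by
  induction h with
  | refl => exact ⟨hroot, hle⟩
  | left x r _ ih =>
    have := ih hroot hle
    simp; omega
  | right l x _ ih =>
    have := ih hroot hle
    simp; omega

/-- A chain rotation creates at most one new left-child pointer. -/
lemma CStep.leftChildCount_le {Y Y' : BT α} (h : CStep Y Y') :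
    leftChildCount Y' ≤ leftChildCount Y + 1 := by
  rcases h with (⟨A, w, U, V, lv, hs, hc⟩ | ⟨A, w, U, V, rv, hs, hc⟩) |
    (⟨A, w, B, X, X', hs, hc⟩ | ⟨B, w, A, X, X', hs, hc⟩)
  · have := hs.leftChildCount_add_rootCount
    refine (hc.leftChildCount_le ?_ ?_).2 <;> simp <;> omega
  · have := hs.leftChildCount_eq
    have := rootCount_le_one rv
    refine (hc.leftChildCount_le ?_ ?_).2 <;> simp <;> omega
  · have := hs.leftChildCount_add_rootCount
    have := rootCount_le_one B
    refine (hc.leftChildCount_le ?_ ?_).2 <;> simp <;> omega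
  · have := hs.leftChildCount_eq
    refine (hc.leftChildCount_le ?_ ?_).2 <;> simp <;> omega

lemma ReachIn.leftChildCount_le {k : ℕ} {S T : BT α} (h : ReachIn k S T) :
    leftChildCount T ≤ leftChildCount S + k := by
  induction k generalizing S with
  | zero => cases h; simp
  | succ k ih =>
    obtain ⟨Y, hY, hT⟩ := h
    have := hY.leftChildCount_le
    have := ih hT
    omega

lemma CStep.node_right {Y Y' : BT α} (l : BT α) (x : α) (h : CStep Y Y') :
    CStep (node l x Y) (node l x Y') := by
  rcases h with (⟨A, w, U, V, lv, hs, hc⟩ | ⟨A, w, U, V, rv, hs, hc⟩) |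
    (⟨A, w, B, X, X', hs, hc⟩ | ⟨B, w, A, X, X', hs, hc⟩)
  · exact .inl (.inl ⟨A, w, U, V, lv, hs, .right l x hc⟩)
  · exact .inl (.inr ⟨A, w, U, V, rv, hs, .right l x hc⟩)
  · exact .inr (.inl ⟨A, w, B, X, X', hs, .right l x hc⟩)
  · exact .inr (.inr ⟨B, w, A, X, X', hs, .right l x hc⟩)

lemma ReachIn.node_right {k : ℕ} {S T : BT α} (l : BT α) (x : α) (h : ReachIn k S T) :
    ReachIn k (node l x S) (node l x T) := by
  induction k generalizing S with
  | zero => cases h; rfl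
  | succ k ih =>
    obtain ⟨Y, hY, hT⟩ := h
    exact ⟨node l x Y, hY.node_right l x, ih hT⟩

lemma ReachIn.tail {k : ℕ} {S T T' : BT α} (h : ReachIn k S T) (hT : CStep T T') :
    ReachIn (k + 1) S T' := by
  induction k generalizing S with
  | zero => cases h; exact ⟨T', hT, rfl⟩
  | succ k ih =>
    obtain ⟨Y, hY, h⟩ := h
    exact ⟨Y, hY, ih h⟩

lemma spliceL_leftChain (n : ℕ) :
    SpliceL nil () (leftChain (n + 1)) (leftChain (n + 2)) nil := by
  induction n with
  | zero => exact .base nil nil ()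
  | succ n ih => exact .step () nil ih

lemma reachIn_rightChain_leftChain (n : ℕ) :
    ReachIn n (rightChain (n + 1)) (leftChain (n + 1)) := by
  induction n with
  | zero => rfl
  | succ n ih =>
    exact (ih.node_right nil ()).tail
      (.inl (.inl ⟨nil, (), _, _, nil, spliceL_leftChain n, .refl _ _⟩))

lemma leftChildCount_rightChain (n : ℕ) : leftChildCount (rightChain n) = 0 := by
  induction n with
  | zero => simp [rightChain]
  | succ n ih => simp [rightChain, ih]

lemma leftChildCount_leftChain_succ (n : ℕ) : leftChildCount (leftChain (n + 1)) = n := by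
  induction n with
  | zero => simp [leftChain]
  | succ n ih =>
    rw [leftChain, leftChildCount_node, ih]
    simp [leftChain]

end BT

open BT

/-- for every `n ≥ 1`, the chain distance between the complete right
chain on `n` vertices and the complete left chain on `n` vertices is exactly `n − 1`. -/
theorem chainDist_rightChain_leftChain (n : ℕ) (hn : 1 ≤ n) :
    chainDist (rightChain n) (leftChain n) = n - 1 := by
  obtain ⟨m, rfl⟩ := Nat.exists_eq_add_of_le' hn
  have hm : ReachIn m (rightChain (m + 1)) (leftChain (m + 1)) := reachIn_rightChain_leftChain m
  refine le_antisymm (Nat.sInf_le hm) (le_csInf ⟨m, hm⟩ fun k hk => ?_)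
  have := ReachIn.leftChildCount_le hk
  rw [leftChildCount_rightChain, leftChildCount_leftChain_succ] at this
  omega
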